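/- Let p be a depth-zero pattern of dimensions a×c having exactly one bifix o, and write p = p'' o where p'' has dimensions b×d. Then for all integers m ≥ n ≥ 1, the following identity holds in ℚ: s_p(n, m) = (m − n + 1) · Σ (−1)^{j+l} · M(N; j, k, l) · (1/N) · C(m + n − (a+c−1)j − (b+d)(k+l), N − l − 1), where the sum is over all j, k, l ≥ 0 with a·j + (b+1)·k + b·l ≤ n, N denotes n − (a−1)j − b·k − (b−1)l, M(N; j,k,l) = N!/(j!·k!·l!·(N−j−k−l)!) is the multinomial coefficient, and the binomial coefficient C(x, y) is taken to be 0 when y < 0. -/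

import Mathlib

/-- A step of a lattice path: `u` (up) or `r` (right). -/
inductive Step : Type
  | u : Step
  | r : Step
deriving DecidableEq

/-- A word over the alphabet `{u, r}`. -/
abbrev Word := List Step

/-- The number of letters `r` in a word. -/
def countR (w : Word) : ℕ := w.count Step.r

/-- The number of letters `u` in a word. -/
def countU (w : Word) : ℕ := w.count Step.u

/-- `dval q` = (number of `r`'s in `q`) - (number of `u`'s in `q`). -/
def dval (w : Word) : ℤ := (countR w : ℤ) - (countU w : ℤ)

/-- A pattern is depth-zero if every suffix `q` of it satisfies `dval q ≥ 0`. -/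
def DepthZero (p : Word) : Prop := ∀ q : Word, q <:+ p → 0 ≤ dval q

/-- `o` is a bifix of `p`: a nonempty proper prefix of `p` that is also a (proper) suffix. -/
def IsBifix (o p : Word) : Prop := o ≠ [] ∧ o ≠ p ∧ o <+: p ∧ o <:+ p

/-- A pattern is bifix-free if it has no bifix. -/
def BifixFree (p : Word) : Prop := ∀ o : Word, ¬ IsBifix o p

/-- `w` is a ballot path to the lattice point `(n, m)`: it has exactly `n` letters `r`
and `m` letters `u`, and every prefix has at least as many `u`'s as `r`'s. -/
def IsBallot (w : Word) (n m : ℤ) : Prop :=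
  (countR w : ℤ) = n ∧ (countU w : ℤ) = m ∧
    ∀ t : Word, t <+: w → countR t ≤ countU t

/-- `w` avoids the pattern `p`: `p` does not occur in `w` as a contiguous substring. -/
def Avoids (p w : Word) : Prop := ¬ p <:+: w

/-- `s p n m` is the number of ballot paths to `(n, m)` avoiding `p`
(`0` if `n < 0`, `m < 0`, or `m < n`, since then no such path exists). -/
noncomputable def s (p : Word) (n m : ℤ) : ℕ :=
  Set.ncard {w : Word | IsBallot w n m ∧ Avoids p w}

theorem countR_append (v w : Word) : countR (v ++ w) = countR v + countR w :=
  List.count_append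

theorem countU_append (v w : Word) : countU (v ++ w) = countU v + countU w :=
  List.count_append

theorem countR_add_countU (w : Word) : countR w + countU w = w.length := by
  induction w with
  | nil => rfl
  | cons x w ih =>
    unfold countR countU at ih ⊢
    cases x <;> simp <;> omega

instance : Finite Step :=
  Finite.of_injective (fun x : Step => decide (x = Step.u)) (by
    intro x y; cases x <;> cases y <;> simp)

theorem finite_setOf_isBallot (n m : ℤ) (P : Word → Prop) :
    {w : Word | IsBallot w n m ∧ P w}.Finite := by
  refine (List.finite_length_eq Step (n + m).toNat).subset ?_
  rintro w ⟨⟨hr, hu, -⟩, -⟩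
  have := countR_add_countU w
  simp only [Set.mem_ofPred_eq]
  omega

theorem DepthZero.suffix {p q : Word} (h : DepthZero p) (hq : q <:+ p) : DepthZero q :=
  fun _ hv => h _ (hv.trans hq)

theorem DepthZero.countU_le {p : Word} (h : DepthZero p) : countU p ≤ countR p := by
  have := h p List.suffix_rfl
  unfold dval at this
  omega

theorem DepthZero.countR_pos {p : Word} (h : DepthZero p) (hp : p ≠ []) : 1 ≤ countR p := by
  have := h.countU_le
  have := countR_add_countU p
  have := List.length_pos_of_ne_nil hp
  omega

/-- Appending a depth-zero word to a word does not create a violation of the ballot condition,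
provided the end point satisfies it. -/
theorem isBallot_append_iff {w q : Word} (hq : DepthZero q) {n m : ℤ} (hnm : n ≤ m) :
    IsBallot (w ++ q) n m ↔ IsBallot w (n - countR q) (m - countU q) := by
  unfold IsBallot
  rw [countR_append, countU_append]
  constructor
  · rintro ⟨h1, h2, h3⟩
    refine ⟨by omega, by omega, fun t ht => h3 t (ht.trans (List.prefix_append _ _))⟩
  · rintro ⟨h1, h2, h3⟩
    refine ⟨by omega, by omega, fun t ht => ?_⟩
    rcases List.prefix_or_prefix_of_prefix ht (List.prefix_append w q) with h | h
    · exact h3 t h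
    · obtain ⟨v, rfl⟩ := h
      obtain ⟨x, hx⟩ := ht
      have hx' : v ++ x = q := by simpa using hx
      subst hx'
      have := (hq.suffix (List.suffix_append v x)).countU_le
      simp only [countR_append, countU_append] at *
      omega

theorem isBallot_concat_iff {w : Word} {x : Step} {n m : ℤ} (hnm : n ≤ m) :
    IsBallot (w ++ [x]) n m ↔ IsBallot w (n - countR [x]) (m - countU [x]) := by
  unfold IsBallot
  simp only [List.prefix_concat_iff, forall_eq_or_imp, countR_append, countU_append]
  constructor
  · rintro ⟨h1, h2, -, h3⟩
    exact ⟨by omega, by omega, h3⟩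
  · rintro ⟨h1, h2, h3⟩
    exact ⟨by omega, by omega, by omega, h3⟩

/-- The pattern `p` occurs in `w` as a suffix, and nowhere else. -/
def EndsFirst (p w : Word) : Prop := p <:+ w ∧ Avoids p w.dropLast

/-- The number of ballot paths to `(n, m)` whose first occurrence of `p` is at their end. -/
noncomputable def endsFirstCount (p : Word) (n m : ℤ) : ℕ :=
  Set.ncard {w : Word | IsBallot w n m ∧ EndsFirst p w}

theorem avoids_concat_iff {p w : Word} {x : Step} :
    Avoids p (w ++ [x]) ↔ ¬ p <:+ w ++ [x] ∧ Avoids p w := by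
  unfold Avoids
  rw [List.infix_concat_iff, not_or]

theorem avoids_or_endsFirst_concat_iff {p w : Word} {x : Step} :
    Avoids p (w ++ [x]) ∨ EndsFirst p (w ++ [x]) ↔ Avoids p w := by
  rw [avoids_concat_iff, EndsFirst, List.dropLast_concat]
  tauto

theorem s_add_endsFirstCount (p : Word) {n m : ℤ} (hnm : n ≤ m) (h0 : n + m ≠ 0) :
    s p n m + endsFirstCount p n m = s p n (m - 1) + s p (n - 1) m := by
  have hu : countR [Step.u] = 0 ∧ countU [Step.u] = 1 := ⟨rfl, rfl⟩
  have hr : countR [Step.r] = 1 ∧ countU [Step.r] = 0 := ⟨rfl, rfl⟩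
  have hinj : ∀ x : Step, Function.Injective (fun w : Word => w ++ [x]) :=
    fun x => List.append_left_injective [x]
  unfold s endsFirstCount
  rw [← Set.ncard_union_eq _ (finite_setOf_isBallot _ _ _) (finite_setOf_isBallot _ _ _),
    ← Set.ncard_image_of_injective {w : Word | IsBallot w n (m - 1) ∧ Avoids p w} (hinj Step.u),
    ← Set.ncard_image_of_injective {w : Word | IsBallot w (n - 1) m ∧ Avoids p w} (hinj Step.r),
    ← Set.ncard_union_eq _ ((finite_setOf_isBallot _ _ _).image _)
      ((finite_setOf_isBallot _ _ _).image _)]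
  · congr 1
    ext w
    rcases List.eq_nil_or_concat' w with rfl | ⟨w, x, rfl⟩
    · have : ¬ IsBallot [] n m := by
        rintro ⟨h1, h2, -⟩
        simp [countR, countU] at h1 h2
        omega
      simp [this]
    · simp only [Set.mem_union, Set.mem_ofPred_eq, ← and_or_left, avoids_or_endsFirst_concat_iff,
        isBallot_concat_iff hnm, Set.mem_image]
      cases x <;> simp [hu, hr]
  · rw [Set.disjoint_left]
    rintro _ ⟨v, -, rfl⟩ ⟨w, -, h⟩
    simp at h
  · rw [Set.disjoint_left]
    rintro w ⟨-, hw⟩ ⟨-, hw', -⟩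
    exact hw hw'.isInfix

theorem EndsFirst.avoids_of_append {p w q : Word} (hq : q ≠ []) (h : EndsFirst p (w ++ q)) :
    Avoids p w := by
  intro hw
  refine h.2 (hw.trans ?_)
  rw [List.dropLast_append_of_ne_nil hq]
  exact (List.prefix_append _ _).isInfix

/-- An occurrence of `p` inside `w ++ q`, with `q` a prefix of `p` and `w` avoiding `p`,
yields a bifix of `p` unless it ends exactly where `q = p` does. -/
theorem isBifix_of_append_eq {p w q v x : Word} (hw : Avoids p w)
    (hq : q <+: p) (h : w ++ q = v ++ p ++ x) (hx : x ≠ [] ∨ q ≠ p) :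
    ∃ o', IsBifix o' p ∧ w ++ o' = v ++ p ∧ o' ++ x = q := by
  have hlen : x.length < q.length := by
    by_contra hlt
    have h1 : w <+: v ++ p ++ x := ⟨q, h⟩
    have h2 : v ++ p <+: v ++ p ++ x := List.prefix_append _ _
    have h3 := congrArg List.length h
    simp only [List.length_append] at h3
    have h4 : v ++ p <+: w :=
      List.prefix_of_prefix_length_le h2 h1 (by simp only [List.length_append]; omega)
    exact hw ((List.suffix_append v p).isInfix.trans h4.isInfix)
  obtain ⟨o', rfl⟩ : x <:+ q :=
    List.suffix_of_suffix_length_le ⟨v ++ p, h.symm⟩ (List.suffix_append w q) hlen.le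
  have h1 : w ++ o' = v ++ p := by
    rw [← List.append_assoc] at h
    exact List.append_cancel_right h
  have hlen' := hq.length_le
  simp only [List.length_append] at hlen hlen'
  refine ⟨o', ⟨?_, ?_, (List.prefix_append o' x).trans hq, ?_⟩, h1, rfl⟩
  · rintro rfl
    simp at hlen
  · rintro rfl
    have : x = [] := List.eq_nil_of_length_eq_zero (by omega)
    subst this
    simp at hx
  · exact List.suffix_of_suffix_length_le (l₃ := v ++ p) (h1 ▸ List.suffix_append w o')
      (List.suffix_append v p) (by omega)

section OneBifix

variable {p o : Word}

theorem endsFirst_append_bifix_of_not {w : Word} (huniq : ∀ o' : Word, IsBifix o' p → o' = o)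
    (ho : IsBifix o p) (hw : Avoids p w) (h : ¬ EndsFirst p (w ++ p)) : EndsFirst p (w ++ o) := by
  have hp : p ≠ [] := by
    rintro rfl
    exact ho.1 (List.prefix_nil.1 ho.2.2.1)
  have h' : p <:+: (w ++ p).dropLast := by
    by_contra hc
    exact h ⟨List.suffix_append w p, hc⟩
  obtain ⟨v, x, hvx⟩ := h'
  have hne : w ++ p ≠ [] := by simp [hp]
  have h1 : w ++ p = v ++ p ++ (x ++ [(w ++ p).getLast hne]) := by
    rw [← List.append_assoc, hvx, List.dropLast_append_getLast]
  obtain ⟨o', ho', h2, -⟩ := isBifix_of_append_eq hw List.prefix_rfl h1 (Or.inl (by simp))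
  obtain rfl := huniq o' ho'
  refine ⟨h2 ▸ List.suffix_append v p, ?_⟩
  rintro ⟨v', x', hvx'⟩
  have hne' : w ++ o' ≠ [] := by simp [ho.1]
  have h3 : w ++ o' = v' ++ p ++ (x' ++ [(w ++ o').getLast hne']) := by
    rw [← List.append_assoc, hvx', List.dropLast_append_getLast]
  obtain ⟨o'', ho'', -, h4⟩ := isBifix_of_append_eq hw ho.2.2.1 h3 (Or.inl (by simp))
  obtain rfl := huniq o'' ho''
  simp at h4

theorem not_endsFirst_append_of_bifix {w : Word} (ho : IsBifix o p)
    (h : EndsFirst p (w ++ o)) : ¬ EndsFirst p (w ++ p) := by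
  obtain ⟨q, hq⟩ := ho.2.2.1
  have hq' : q ≠ [] := by
    rintro rfl
    exact ho.2.1 (by simpa using hq)
  intro h'
  rw [← hq, ← List.append_assoc, hq] at h'
  exact h'.avoids_of_append hq' h.1.isInfix

theorem s_eq_endsFirstCount_add (hdz : DepthZero p) (ho : IsBifix o p)
    (huniq : ∀ o' : Word, IsBifix o' p → o' = o) {p'' : Word} (hsplit : p = p'' ++ o)
    {n m : ℤ} (hnm : n ≤ m)
    (hnm' : n - countR p'' ≤ m - countU p'') :
    s p (n - countR p) (m - countU p) =
      endsFirstCount p n m + endsFirstCount p (n - countR p'') (m - countU p'') := by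
  have hdo : DepthZero o := hdz.suffix ho.2.2.2
  have hp : p ≠ [] := by
    rintro rfl
    exact ho.1 (List.prefix_nil.1 ho.2.2.1)
  have key : ∀ q : Word, q ≠ [] → DepthZero q → q <:+ p → ∀ n m : ℤ, n ≤ m →
      endsFirstCount p n m = Set.ncard {w : Word | IsBallot w (n - countR q) (m - countU q) ∧
        Avoids p w ∧ EndsFirst p (w ++ q)} := by
    intro q hq hdq hqp n m hnm
    rw [← Set.ncard_image_of_injective _ (List.append_left_injective q), endsFirstCount]
    congr 1
    ext x
    simp only [Set.mem_ofPred_eq, Set.mem_image]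
    constructor
    · rintro ⟨hx, hx'⟩
      obtain ⟨w, rfl⟩ := hqp.trans hx'.1
      exact ⟨w, ⟨(isBallot_append_iff hdq hnm).1 hx, hx'.avoids_of_append hq, hx'⟩, rfl⟩
    · rintro ⟨w, ⟨h1, -, h2⟩, rfl⟩
      exact ⟨(isBallot_append_iff hdq hnm).2 h1, h2⟩
  rw [key p hp hdz List.suffix_rfl n m hnm, key o ho.1 hdo ho.2.2.2 _ _ hnm']
  have hR : countR p = countR p'' + countR o := by rw [← countR_append, ← hsplit]
  have hU : countU p = countU p'' + countU o := by rw [← countU_append, ← hsplit]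
  have e1 : n - countR p'' - countR o = n - countR p := by omega
  have e2 : m - countU p'' - countU o = m - countU p := by omega
  rw [e1, e2, ← Set.ncard_union_eq _ (finite_setOf_isBallot _ _ _) (finite_setOf_isBallot _ _ _), s]
  · congr 1
    ext w
    simp only [Set.mem_union, Set.mem_ofPred_eq]
    have := endsFirst_append_bifix_of_not (w := w) huniq ho
    tauto
  · rw [Set.disjoint_left]
    rintro w ⟨-, -, h⟩ ⟨-, -, h'⟩
    exact not_endsFirst_append_of_bifix ho h' h

end OneBifix

theorem s_eq_zero_of_neg (p : Word) {n m : ℤ} (h : n < 0) : s p n m = 0 := by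
  have : {w : Word | IsBallot w n m ∧ Avoids p w} = ∅ := by
    ext w
    simp only [Set.mem_ofPred_eq, Set.mem_empty_iff_false, iff_false]
    rintro ⟨⟨h1, -, -⟩, -⟩
    omega
  rw [s, this, Set.ncard_empty]

theorem s_eq_zero_of_lt (p : Word) {n m : ℤ} (h : m < n) : s p n m = 0 := by
  have : {w : Word | IsBallot w n m ∧ Avoids p w} = ∅ := by
    ext w
    simp only [Set.mem_ofPred_eq, Set.mem_empty_iff_false, iff_false]
    rintro ⟨⟨h1, h2, h3⟩, -⟩
    have := h3 w List.prefix_rfl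
    omega
  rw [s, this, Set.ncard_empty]

theorem endsFirstCount_eq_zero_of_lt {p : Word} {n m : ℤ} (h : n < countR p) :
    endsFirstCount p n m = 0 := by
  have : {w : Word | IsBallot w n m ∧ EndsFirst p w} = ∅ := by
    ext w
    simp only [Set.mem_ofPred_eq, Set.mem_empty_iff_false, iff_false]
    rintro ⟨⟨h1, -, -⟩, ⟨v, rfl⟩, -⟩
    rw [countR_append] at h1
    omega
  rw [endsFirstCount, this, Set.ncard_empty]

theorem s_zero_zero {p : Word} (hp : p ≠ []) : s p 0 0 = 1 := by
  have : {w : Word | IsBallot w 0 0 ∧ Avoids p w} = {[]} := by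
    ext w
    simp only [Set.mem_ofPred_eq, Set.mem_singleton_iff]
    constructor
    · rintro ⟨⟨h1, h2, -⟩, -⟩
      have := countR_add_countU w
      exact List.eq_nil_of_length_eq_zero (by omega)
    · rintro rfl
      exact ⟨⟨rfl, rfl, by simp [countR]⟩, fun h => hp (List.infix_nil.1 h)⟩
  rw [s, this, Set.ncard_singleton]

theorem s_zero_natCast {p : Word} (hp : p ≠ []) (hR : 1 ≤ countR p) (m : ℕ) : s p 0 m = 1 := by
  induction m with
  | zero => exact s_zero_zero hp
  | succ m ih =>
    have h := s_add_endsFirstCount p (n := 0) (m := (m + 1 : ℕ)) (by omega) (by omega)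
    rw [s_eq_zero_of_neg p (n := 0 - 1) (by omega), endsFirstCount_eq_zero_of_lt (by omega)] at h
    simpa [ih] using h

section CoefficientSum

open PowerSeries

local notation "R" => PowerSeries ℚ

/-- The diagonal sum `∑_{N < B} [z^N] (f * G^N)`, which appears in Lagrange inversion. -/
noncomputable def diagSum (G : PowerSeries R) (B : ℕ) (f : PowerSeries R) : R :=
  ∑ N ∈ Finset.range B, coeff N (f * G ^ N)

variable {G : PowerSeries R} {B : ℕ}

theorem diagSum_add (f g : PowerSeries R) :
    diagSum G B (f + g) = diagSum G B f + diagSum G B g := by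
  simp [diagSum, add_mul, Finset.sum_add_distrib]

theorem diagSum_sub (f g : PowerSeries R) :
    diagSum G B (f - g) = diagSum G B f - diagSum G B g := by
  simp [diagSum, sub_mul, Finset.sum_sub_distrib]

theorem diagSum_C_mul (c : R) (f : PowerSeries R) :
    diagSum G B (C c * f) = c * diagSum G B f := by
  simp [diagSum, mul_assoc, Finset.mul_sum]

theorem coeff_coeff_mul_pow_eq_zero (hG : C X ∣ G) (f : PowerSeries R) {n N : ℕ} (h : n < N)
    (k : ℕ) : coeff n (coeff k (f * G ^ N)) = 0 := by
  obtain ⟨H, rfl⟩ := hG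
  rw [show f * (C X * H) ^ N = C (X ^ N) * (f * H ^ N) by rw [map_pow]; ring, coeff_C_mul,
    coeff_X_pow_mul', if_neg (by omega)]

theorem coeff_diagSum_X_sub_mul (hG : C X ∣ G) (f : PowerSeries R) {n : ℕ} (h : n ≤ B) :
    coeff n (diagSum G (B + 1) ((X - G) * f)) = 0 := by
  have h1 : diagSum G (B + 1) (X * f) = diagSum G B (G * f) := by
    unfold diagSum
    rw [Finset.sum_range_succ', add_eq_left.2]
    · refine Finset.sum_congr rfl fun N _ => ?_
      rw [mul_assoc, coeff_succ_X_mul, pow_succ]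
      congr 1
      ring
    · simp
  have h2 : diagSum G (B + 1) (G * f) = diagSum G B (G * f) + coeff B (f * G ^ (B + 1)) := by
    unfold diagSum
    rw [Finset.sum_range_succ, pow_succ]
    congr 2
    ring
  rw [sub_mul, diagSum_sub, h1, h2, sub_add_cancel_left, map_neg,
    coeff_coeff_mul_pow_eq_zero hG _ (by omega), neg_zero]

theorem derivative_mul_eq {S : Type*} [CommSemiring S] (f g : PowerSeries S) :
    derivative S (f * g) = f * derivative S g + g * derivative S f :=
  (derivative S).leibniz f g

/-- The operator `t ∂/∂t` acting on coefficients in `ℚ⟦t⟧`. -/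
noncomputable def coeffEuler (f : PowerSeries R) : PowerSeries R :=
  PowerSeries.mk fun k => X * derivative ℚ (coeff k f)

theorem coeff_coeff_coeffEuler (f : PowerSeries R) (n k : ℕ) :
    coeff n (coeff k (coeffEuler f)) = n * coeff n (coeff k f) := by
  rw [coeffEuler, coeff_mk]
  cases n with
  | zero => simp
  | succ n => rw [coeff_succ_X_mul, coeff_derivative]; push_cast; ring

theorem coeffEuler_mul (f g : PowerSeries R) :
    coeffEuler (f * g) = f * coeffEuler g + coeffEuler f * g := by
  ext1 k
  simp only [coeffEuler, map_add, coeff_mul, coeff_mk, map_sum, Derivation.leibniz, smul_eq_mul,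
    Finset.mul_sum, ← Finset.sum_add_distrib]
  refine Finset.sum_congr rfl fun _ _ => ?_
  ring

theorem coeffEuler_pow (f : PowerSeries R) (N : ℕ) :
    coeffEuler (f ^ (N + 1)) = (N + 1 : PowerSeries R) * f ^ N * coeffEuler f := by
  induction N with
  | zero => simp
  | succ N ih => rw [pow_succ, coeffEuler_mul, ih]; push_cast; ring

theorem coeffEuler_map_C (f : PowerSeries ℚ) : coeffEuler (PowerSeries.map C f) = 0 := by
  ext1 k
  simp [coeffEuler]

local notation "ι" => (PowerSeries.mk 1 : PowerSeries R)

theorem geom_mul_one_sub_X : ι * (1 - X) = 1 := mk_one_mul_one_sub_eq_one _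

theorem coeffEuler_geom_pow (e : ℕ) : coeffEuler (ι ^ e) = 0 := by
  have : ι ^ e = PowerSeries.map C ((PowerSeries.mk 1 : PowerSeries ℚ) ^ e) := by
    rw [map_pow]
    congr 1
  rw [this, coeffEuler_map_C]

theorem derivative_geom_pow (e : ℕ) :
    derivative R (ι ^ (e + 1)) = (e + 1 : PowerSeries R) * ι ^ (e + 2) := by
  have h1 : derivative R ι = ι ^ 2 := by
    have h := congrArg (derivative R) (geom_mul_one_sub_X)
    rw [derivative_mul_eq, map_sub, derivative_one, derivative_X] at h
    have h2 := geom_mul_one_sub_X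
    linear_combination ι * h - (derivative R ι) * h2
  rw [derivative_pow, h1]
  simp only [add_tsub_cancel_right]
  push_cast
  ring

theorem coeff_geom_pow (e k : ℕ) : coeff k (ι ^ (e + 1)) = ((e + k).choose k : R) := by
  rw [mk_one_pow_eq_mk_choose_add, coeff_mk, Nat.choose_symm_add]

/-- The weight for which `diagSum` yields the Sheffer sequence vanishing on the line
`m = n - 1`. -/
noncomputable def shefferWeight (G : PowerSeries R) : PowerSeries R :=
  (1 - X) * (1 - derivative R G) - coeffEuler G

theorem coeff_diagSum_shefferWeight (hG : C X ∣ G) (m : ℕ) {n : ℕ} (hn : 1 ≤ n) (h : n < B) :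
    coeff n (diagSum G (B + 1) (shefferWeight G * ι ^ (m + 2))) =
      (m + 1 - n : ℚ) * ∑ N ∈ Finset.range B,
        1 / (N + 1 : ℚ) * coeff n (coeff N (ι ^ (m + 2) * G ^ (N + 1))) := by
  set G' := derivative R G with hG'
  have hw : shefferWeight G * ι ^ (m + 2) =
      ι ^ (m + 1) - (ι ^ (m + 1) * G' + ι ^ (m + 2) * coeffEuler G) := by
    have h2 := geom_mul_one_sub_X
    rw [shefferWeight]
    linear_combination (1 - G') * ι ^ (m + 1) * h2
  rw [hw, diagSum_sub]
  have h1 : coeff n (diagSum G (B + 1) (ι ^ (m + 1))) =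
      ∑ N ∈ Finset.range B, coeff n (coeff (N + 1) (ι ^ (m + 1) * G ^ (N + 1))) := by
    unfold diagSum
    rw [Finset.sum_range_succ', map_add, map_sum, add_eq_left]
    have : coeff 0 (ι ^ (m + 1)) = 1 := by rw [coeff_geom_pow]; simp
    rw [pow_zero, mul_one, this, coeff_one, if_neg (by omega)]
  have h2 : ∀ f, coeff n (diagSum G (B + 1) f) =
      ∑ N ∈ Finset.range B, coeff n (coeff N (f * G ^ N)) := by
    intro f
    unfold diagSum
    rw [Finset.sum_range_succ, map_add, map_sum, coeff_coeff_mul_pow_eq_zero hG _ h, add_zero]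
  rw [map_sub, h1, h2, ← Finset.sum_sub_distrib, Finset.mul_sum]
  refine Finset.sum_congr rfl fun N _ => ?_
  have e1 := coeff_derivative (ι ^ (m + 1) * G ^ (N + 1)) N
  rw [derivative_mul_eq, derivative_geom_pow, derivative_pow, ← hG'] at e1
  simp only [add_tsub_cancel_right] at e1
  have e2 := coeff_coeff_coeffEuler (ι ^ (m + 2) * G ^ (N + 1)) n N
  rw [coeffEuler_mul, coeffEuler_geom_pow, coeffEuler_pow, zero_mul, add_zero] at e2
  have cN : ∀ (k : ℕ) (F : PowerSeries R),
      coeff n (coeff N ((k : PowerSeries R) * F)) = (k : ℚ) * coeff n (coeff N F) := by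
    intro k F
    rw [show (k : PowerSeries R) = C (C (k : ℚ)) by simp, coeff_C_mul, coeff_C_mul]
  have cn : ∀ F : R, coeff n (F * ((N : R) + 1)) = (N + 1 : ℚ) * coeff n F := by
    intro F
    rw [show F * ((N : R) + 1) = C (N + 1 : ℚ) * F by simp; ring, coeff_C_mul]
  have e1' := congrArg (coeff n) e1
  rw [cn, show ι ^ (m + 1) * (((N + 1 : ℕ) : PowerSeries R) * G ^ N * G') +
      G ^ (N + 1) * ((m + 1 : PowerSeries R) * ι ^ (m + 2)) =
      ((N + 1 : ℕ) : PowerSeries R) * (ι ^ (m + 1) * G' * G ^ N) +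
      ((m + 1 : ℕ) : PowerSeries R) * (ι ^ (m + 2) * G ^ (N + 1)) by push_cast; ring,
    map_add, map_add, cN, cN] at e1'
  rw [show ι ^ (m + 2) * ((N + 1 : PowerSeries R) * G ^ N * coeffEuler G) =
      ((N + 1 : ℕ) : PowerSeries R) * (ι ^ (m + 2) * coeffEuler G * G ^ N) by push_cast; ring,
    cN] at e2
  rw [add_mul, map_add, map_add]
  push_cast at e1' e2
  have hN : (N + 1 : ℚ) ≠ 0 := by positivity
  field_simp
  linear_combination -e1' - e2

/-- The kernel `G` such that `z = G(t, z)`, with `z = 1 - y`, is equivalent to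
`(1 - t - y) * (1 + t^b * y^d) + t^a * y^c = 0`. -/
noncomputable def patternKernel (a b c d : ℕ) : PowerSeries R :=
  C X - C (X ^ a) * (1 - X) ^ c + C (X ^ (b + 1)) * (1 - X) ^ d - C (X ^ b) * ((1 - X) ^ d * X)

theorem C_X_dvd_patternKernel {a b : ℕ} (ha : 1 ≤ a) (hb : 1 ≤ b) (c d : ℕ) :
    C X ∣ patternKernel a b c d := by
  have h : ∀ i : ℕ, 1 ≤ i → (C X : PowerSeries R) ∣ C (X ^ i) := fun i hi => by
    rw [map_pow]
    exact dvd_pow_self _ (by omega)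
  exact dvd_sub (dvd_add (dvd_sub dvd_rfl ((h a ha).mul_right _))
    ((h _ (by omega)).mul_right _)) ((h b hb).mul_right _)

theorem X_sub_patternKernel (a b c d : ℕ) :
    X - patternKernel a b c d =
      (X - C X) * (1 + C (X ^ b) * (1 - X) ^ d) + C (X ^ a) * (1 - X) ^ c := by
  rw [patternKernel, pow_succ, map_mul]
  ring

theorem one_sub_X_pow_mul_geom_pow {i e : ℕ} (h : i ≤ e) :
    (1 - X) ^ i * ι ^ e = ι ^ (e - i) := by
  obtain ⟨k, rfl⟩ := Nat.exists_eq_add_of_le h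
  rw [pow_add, ← mul_assoc, ← mul_pow, mul_comm (1 - X), geom_mul_one_sub_X, one_pow, one_mul,
    Nat.add_sub_cancel_left]

theorem coeff_diagSum_zero (hG : C X ∣ G) (e : ℕ) :
    coeff 0 (diagSum G (B + 1) (shefferWeight G * ι ^ e)) = 1 := by
  have h0 : ∀ k, coeff 0 (coeff k G) = 0 := by
    obtain ⟨H, rfl⟩ := hG
    intro k
    rw [coeff_C_mul]
    simp
  have hz : ∀ {S : Type} [Semiring S] (f g : PowerSeries S),
      coeff 0 (f * g) = coeff 0 f * coeff 0 g := by
    intro S _ f g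
    simp
  have hg : coeff 0 (ι ^ e) = 1 := by
    simp
  unfold diagSum
  rw [Finset.sum_range_succ', map_add, map_sum, Finset.sum_eq_zero, zero_add, pow_zero, mul_one]
  · rw [hz, hg, mul_one, shefferWeight, map_sub, map_sub, coeff_coeff_coeffEuler,
      hz, map_sub, map_sub, coeff_derivative]
    have := h0 1
    simp at this
    simp [this]
  · intro N _
    exact coeff_coeff_mul_pow_eq_zero hG _ (by omega) _

theorem coeff_succ_diagSum_mul_C_X_sub_X (f : PowerSeries R) (n e : ℕ) :
    coeff (n + 1) (diagSum G B (f * ι ^ (e + 1) * (C X - X))) =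
      coeff n (diagSum G B (f * ι ^ (e + 1))) + coeff (n + 1) (diagSum G B (f * ι ^ e)) -
        coeff (n + 1) (diagSum G B (f * ι ^ (e + 1))) := by
  have h : f * ι ^ (e + 1) * (C X - X) =
      C X * (f * ι ^ (e + 1)) + f * ι ^ e - f * ι ^ (e + 1) := by
    have := geom_mul_one_sub_X
    linear_combination f * ι ^ e * this
  rw [h, diagSum_sub, diagSum_add, diagSum_C_mul, map_sub, map_add, coeff_succ_X_mul]

theorem coeff_diagSum_patternKernel_recurrence {a b c d : ℕ} (ha : 1 ≤ a) (hb : 1 ≤ b)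
    (f : PowerSeries R) {n : ℕ} (h : n ≤ B) :
    coeff n (diagSum (patternKernel a b c d) (B + 1) (f * (C X - X))) =
      (if a ≤ n then
        coeff (n - a) (diagSum (patternKernel a b c d) (B + 1) ((1 - X) ^ c * f)) else 0) -
      (if b ≤ n then
        coeff (n - b) (diagSum (patternKernel a b c d) (B + 1) ((1 - X) ^ d * f * (C X - X)))
        else 0) := by
  have h0 := coeff_diagSum_X_sub_mul (C_X_dvd_patternKernel ha hb c d) f h
  rw [X_sub_patternKernel, show ((X - C X) * (1 + C (X ^ b) * (1 - X) ^ d) +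
      C (X ^ a) * (1 - X) ^ c) * f = C (X ^ a) * ((1 - X) ^ c * f) -
      C (X ^ b) * ((1 - X) ^ d * f * (C X - X)) - f * (C X - X) by ring, diagSum_sub, diagSum_sub,
    diagSum_C_mul, diagSum_C_mul, map_sub, map_sub, coeff_X_pow_mul', coeff_X_pow_mul'] at h0
  linarith

theorem add_pow_range {S : Type*} [CommSemiring S] (x y : S) {N L : ℕ} (h : N < L) :
    (x + y) ^ N = ∑ j ∈ Finset.range L, (N.choose j : S) * x ^ j * y ^ (N - j) := by
  rw [add_pow]
  refine (Finset.sum_congr rfl fun j _ => ?_).trans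
    (Finset.sum_subset (Finset.range_subset_range.2 h) fun j _ hj => ?_)
  · ring
  · rw [Nat.choose_eq_zero_of_lt (by simpa using hj)]
    simp

theorem add_add_add_pow_range {S : Type*} [CommSemiring S] (x y z w : S) {N L : ℕ} (h : N < L) :
    (x + (y + (z + w))) ^ N =
      ∑ i ∈ Finset.range L ×ˢ Finset.range L ×ˢ Finset.range L,
        ((N.choose i.1 * (N - i.1).choose i.2.1 * (N - i.1 - i.2.1).choose i.2.2 : ℕ) : S) *
          (x ^ i.1 * y ^ i.2.1 * z ^ i.2.2 * w ^ (N - i.1 - i.2.1 - i.2.2)) := by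
  simp only [Finset.sum_product]
  rw [add_pow_range x _ h]
  refine Finset.sum_congr rfl fun j _ => ?_
  rw [add_pow_range y _ (by omega : N - j < L), Finset.mul_sum]
  refine Finset.sum_congr rfl fun k _ => ?_
  rw [add_pow_range z w (by omega : N - j - k < L), Finset.mul_sum, Finset.mul_sum]
  refine Finset.sum_congr rfl fun l _ => ?_
  push_cast
  ring

theorem coeff_coeff_geom_mul_monomial {m q E n : ℕ} (hq : E ≤ n → q ≤ m) (l N : ℕ) :
    coeff n (coeff N (C (X ^ E) * (ι ^ (m + 2) * ((1 - X) ^ q * X ^ l)))) =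
      if E = n ∧ l ≤ N then ((m + 1 - q + (N - l)).choose (N - l) : ℚ) else 0 := by
  rw [coeff_C_mul, coeff_X_pow_mul']
  split_ifs with h1 h2 h2
  · rw [show ι ^ (m + 2) * ((1 - X) ^ q * X ^ l) = X ^ l * ((1 - X) ^ q * ι ^ (m + 2)) by ring,
      one_sub_X_pow_mul_geom_pow (by have := hq h1; omega), coeff_X_pow_mul', if_pos h2.2,
      show m + 2 - q = m + 1 - q + 1 by have := hq h1; omega, coeff_geom_pow, h2.1]
    simp
  · rw [show ι ^ (m + 2) * ((1 - X) ^ q * X ^ l) = X ^ l * ((1 - X) ^ q * ι ^ (m + 2)) by ring,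
      one_sub_X_pow_mul_geom_pow (by have := hq h1; omega), coeff_X_pow_mul']
    split_ifs with h3
    · rw [show m + 2 - q = m + 1 - q + 1 by have := hq h1; omega, coeff_geom_pow,
        ← map_natCast (C : ℚ →+* R), coeff_C, if_neg (by omega)]
    · simp
  · omega
  · rfl

theorem coeff_coeff_geom_mul_patternKernel_pow {a b c d n m N L : ℕ} (hc : c ≤ a) (hd : d ≤ b)
    (hnm : n ≤ m) (hN : N + 1 < L) :
    coeff n (coeff N (ι ^ (m + 2) * patternKernel a b c d ^ (N + 1))) =
      ∑ i ∈ Finset.range L ×ˢ Finset.range L ×ˢ Finset.range L,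
        (((N + 1).choose i.1 * (N + 1 - i.1).choose i.2.1 *
            (N + 1 - i.1 - i.2.1).choose i.2.2 : ℕ) : ℚ) * (-1) ^ (i.1 + i.2.2) *
          if a * i.1 + (b + 1) * i.2.1 + b * i.2.2 + (N + 1 - i.1 - i.2.1 - i.2.2) = n ∧
              i.2.2 ≤ N then
            ((m + 1 - (c * i.1 + d * (i.2.1 + i.2.2)) + (N - i.2.2)).choose (N - i.2.2) : ℚ)
          else 0 := by
  have hG : patternKernel a b c d = -(C (X ^ a) * (1 - X) ^ c) + (C (X ^ (b + 1)) * (1 - X) ^ d +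
      (-(C (X ^ b) * ((1 - X) ^ d * X)) + C X)) := by
    rw [patternKernel]
    ring
  rw [hG, add_add_add_pow_range _ _ _ _ hN, Finset.mul_sum, map_sum, map_sum]
  refine Finset.sum_congr rfl fun ⟨j, k, l⟩ _ => ?_
  dsimp only
  have hq : a * j + (b + 1) * k + b * l + (N + 1 - j - k - l) ≤ n → c * j + d * (k + l) ≤ m := by
    intro h
    have h1 : c * j ≤ a * j := Nat.mul_le_mul_right _ hc
    have h2 : d * (k + l) ≤ b * (k + l) := Nat.mul_le_mul_right _ hd
    rw [mul_add b] at h2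
    rw [add_mul] at h
    omega
  rw [← coeff_coeff_geom_mul_monomial hq, ← coeff_C_mul, ← coeff_C_mul]
  congr 2
  rw [neg_pow (C (X ^ a) * (1 - X) ^ c), neg_pow (C (X ^ b) * ((1 - X) ^ d * X))]
  simp only [map_mul, map_pow, map_neg, map_one, map_natCast]
  ring

end CoefficientSum

theorem choose_mul_choose_mul_choose {N j k l : ℕ} (h : j + k + l ≤ N) :
    N.choose j * (N - j).choose k * (N - j - k).choose l =
      N.factorial / (j.factorial * k.factorial * l.factorial * (N - j - k - l).factorial) := by
  symm
  apply Nat.div_eq_of_eq_mul_left (by positivity)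
  rw [← Nat.choose_mul_factorial_mul_factorial (by omega : j ≤ N),
    ← Nat.choose_mul_factorial_mul_factorial (by omega : k ≤ N - j),
    ← Nat.choose_mul_factorial_mul_factorial (by omega : l ≤ N - j - k)]
  ring

theorem choose_mul_choose_mul_choose_eq_zero {N j k l : ℕ} (h : N < j + k + l) :
    N.choose j * (N - j).choose k * (N - j - k).choose l = 0 := by
  rcases lt_or_ge N j with hj | hj
  · rw [Nat.choose_eq_zero_of_lt hj, zero_mul, zero_mul]
  rcases lt_or_ge (N - j) k with hk | hk
  · rw [Nat.choose_eq_zero_of_lt hk, mul_zero, zero_mul]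
  · rw [Nat.choose_eq_zero_of_lt (by omega : N - j - k < l), mul_zero]

theorem coeff_diagSum_patternKernel_eq_sum {a b c d n m : ℕ} (hc : c ≤ a + 1) (hd : d ≤ b + 1)
    (hn : 1 ≤ n) (hnm : n ≤ m) :
    PowerSeries.coeff n (diagSum (patternKernel (a + 1) (b + 1) c d) (n + 1 + 1)
        (shefferWeight (patternKernel (a + 1) (b + 1) c d) * PowerSeries.mk 1 ^ (m + 2))) =
      ((m : ℚ) - n + 1) *
      ∑ x ∈ Finset.filter
          (fun x : ℕ × ℕ × ℕ => (a + 1) * x.1 + (b + 1 + 1) * x.2.1 + (b + 1) * x.2.2 ≤ n)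
          (Finset.range (n + 1) ×ˢ Finset.range (n + 1) ×ˢ Finset.range (n + 1)),
        (-1 : ℚ) ^ (x.1 + x.2.2) *
          ((Nat.factorial (n - a * x.1 - (b + 1) * x.2.1 - b * x.2.2) /
              (Nat.factorial x.1 * Nat.factorial x.2.1 * Nat.factorial x.2.2 *
                Nat.factorial ((n - a * x.1 - (b + 1) * x.2.1 - b * x.2.2)
                  - x.1 - x.2.1 - x.2.2)) : ℕ) : ℚ) *
          (1 / ((n - a * x.1 - (b + 1) * x.2.1 - b * x.2.2 : ℕ) : ℚ)) *
          (if x.2.2 < n - a * x.1 - (b + 1) * x.2.1 - b * x.2.2 then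
              ((Nat.choose (m + n - (a + 1 + c - 1) * x.1 - (b + 1 + d) * (x.2.1 + x.2.2))
                ((n - a * x.1 - (b + 1) * x.2.1 - b * x.2.2) - x.2.2 - 1)) : ℚ)
            else 0) := by
  rw [coeff_diagSum_shefferWeight (C_X_dvd_patternKernel (by omega) (by omega) c d) m hn
    (Nat.lt_succ_self n), show (m : ℚ) + 1 - n = m - n + 1 by ring]
  congr 1
  rw [Finset.sum_congr rfl fun N hN => by
    rw [coeff_coeff_geom_mul_patternKernel_pow hc hd hnm
      (by simpa using hN : N + 1 < n + 2), Finset.mul_sum], Finset.sum_comm]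
  symm
  have hsub : Finset.filter
      (fun x : ℕ × ℕ × ℕ => (a + 1) * x.1 + (b + 1 + 1) * x.2.1 + (b + 1) * x.2.2 ≤ n)
      (Finset.range (n + 1) ×ˢ Finset.range (n + 1) ×ˢ Finset.range (n + 1)) ⊆
      Finset.range (n + 2) ×ˢ Finset.range (n + 2) ×ˢ Finset.range (n + 2) := by
    rintro ⟨j, k, l⟩ h
    simp only [Finset.mem_filter, Finset.mem_product, Finset.mem_range] at h ⊢
    omega
  refine (Finset.sum_congr rfl ?_).trans (Finset.sum_subset hsub ?_)
  · rintro ⟨j, k, l⟩ h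
    simp only [Finset.mem_filter, Finset.mem_product, Finset.mem_range] at h
    dsimp only
    obtain ⟨-, h⟩ := h
    obtain ⟨N, hN⟩ : ∃ N, n - a * j - (b + 1) * k - b * l = N + 1 := by
      simp only [add_mul, one_mul] at h ⊢
      refine Nat.exists_eq_add_one.2 ?_
      by_contra h0
      have hj : j = 0 := by omega
      have hk : k = 0 := by omega
      have hl : l = 0 := by omega
      subst hj hk hl
      omega
    have hle : j + k + l ≤ N + 1 := by
      simp only [add_mul, one_mul] at h hN
      omega
    rw [Finset.sum_eq_single N]
    · rw [hN, choose_mul_choose_mul_choose hle]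
      have hE : (a + 1) * j + (b + 1 + 1) * k + (b + 1) * l + (N + 1 - j - k - l) = n := by
        simp only [add_mul, one_mul] at h hN ⊢
        omega
      have hcd : c * j ≤ (a + 1) * j ∧ d * k ≤ (b + 1) * k ∧ d * l ≤ (b + 1) * l :=
        ⟨Nat.mul_le_mul_right _ hc, Nat.mul_le_mul_right _ hd, Nat.mul_le_mul_right _ hd⟩
      by_cases hl : l ≤ N
      · rw [if_pos (Nat.lt_succ_of_le hl), if_pos ⟨hE, hl⟩, show N + 1 - l - 1 = N - l by omega,
          show m + n - (a + 1 + c - 1) * j - (b + 1 + d) * (k + l) =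
            m + 1 - (c * j + d * (k + l)) + (N - l) by
          rw [show a + 1 + c - 1 = a + c by omega]
          simp only [add_mul, mul_add, one_mul] at h hN hE hcd ⊢
          omega]
        push_cast
        ring
      · rw [if_neg (by omega), if_neg (by tauto)]
        ring
    · intro N' _ hne
      rcases lt_or_ge (N' + 1) (j + k + l) with hlt | hge
      · rw [choose_mul_choose_mul_choose_eq_zero hlt, Nat.cast_zero, zero_mul, zero_mul, mul_zero]
      · rw [if_neg, mul_zero, mul_zero]
        simp only [add_mul, one_mul] at h hN ⊢
        omega
    · intro hN'
      exfalso
      simp only [Finset.mem_range] at hN'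
      omega
  · rintro ⟨j, k, l⟩ - h
    refine Finset.sum_eq_zero fun N _ => ?_
    dsimp only
    rw [if_neg, mul_zero, mul_zero]
    rintro ⟨hE, -⟩
    apply h
    simp only [Finset.mem_filter, Finset.mem_product, Finset.mem_range]
    simp only [add_mul, one_mul] at hE ⊢
    generalize a * j = A at *
    generalize b * k = K at *
    generalize b * l = L at *
    omega

theorem s_eq_coeff_diagSum {p o p'' : Word} {a b c d B : ℕ} (hdz : DepthZero p)
    (ho : IsBifix o p) (huniq : ∀ o' : Word, IsBifix o' p → o' = o) (hsplit : p = p'' ++ o)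
    (hdimR : countR p = a) (hdimU : countU p = c) (hdimR'' : countR p'' = b)
    (hdimU'' : countU p'' = d) (hb : 1 ≤ b) (hd : d ≤ b) {n m : ℕ} (hn : n < B) (hnm : n ≤ m) :
    (s p n m : ℚ) = PowerSeries.coeff n (diagSum (patternKernel a b c d) (B + 1)
        (shefferWeight (patternKernel a b c d) * PowerSeries.mk 1 ^ (m + 2))) ∧
      (endsFirstCount p n m : ℚ) = PowerSeries.coeff n (diagSum (patternKernel a b c d) (B + 1)
        (shefferWeight (patternKernel a b c d) * PowerSeries.mk 1 ^ (m + 2) *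
          (PowerSeries.C PowerSeries.X - PowerSeries.X))) := by
  have hp : p ≠ [] := by
    rintro rfl
    exact ho.1 (List.prefix_nil.1 ho.2.2.1)
  have ha : 1 ≤ a := hdimR ▸ hdz.countR_pos hp
  have hc : c ≤ a := hdimR ▸ hdimU ▸ hdz.countU_le
  have hG := C_X_dvd_patternKernel ha hb c d
  induction n using Nat.strong_induction_on generalizing m with
  | _ n ih =>
  have hends : ∀ m : ℕ, n ≤ m → (endsFirstCount p n m : ℚ) =
      PowerSeries.coeff n (diagSum (patternKernel a b c d) (B + 1)
        (shefferWeight (patternKernel a b c d) * PowerSeries.mk 1 ^ (m + 2) *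
          (PowerSeries.C PowerSeries.X - PowerSeries.X))) := by
    intro m hnm
    have key := s_eq_endsFirstCount_add hdz ho huniq hsplit (n := n) (m := m) (by omega) (by omega)
    rw [hdimR, hdimU, hdimR'', hdimU''] at key
    have key' : (endsFirstCount p n m : ℚ) =
        (s p (n - a) (m - c) : ℚ) - (endsFirstCount p (n - b) (m - d) : ℚ) := by
      rw [key]
      push_cast
      ring
    rw [key', coeff_diagSum_patternKernel_recurrence ha hb _ hn.le]
    congr 1
    · split_ifs with h
      · rw [mul_left_comm, one_sub_X_pow_mul_geom_pow (by omega),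
          show m + 2 - c = m - c + 2 by omega, ← (ih (n - a) (by omega) (by omega)
            (by omega : n - a ≤ m - c)).1, Nat.cast_sub h, Nat.cast_sub (by omega)]
      · rw [s_eq_zero_of_neg p (by omega), Nat.cast_zero]
    · split_ifs with h
      · rw [mul_left_comm, one_sub_X_pow_mul_geom_pow (by omega),
          show m + 2 - d = m - d + 2 by omega, ← (ih (n - b) (by omega) (by omega)
            (by omega : n - b ≤ m - d)).2, Nat.cast_sub h, Nat.cast_sub (by omega)]
      · rw [endsFirstCount_eq_zero_of_lt (by omega), Nat.cast_zero]
  refine ⟨?_, hends m hnm⟩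
  cases n with
  | zero =>
    rw [coeff_diagSum_zero hG, Nat.cast_zero, s_zero_natCast hp (by omega), Nat.cast_one]
  | succ n =>
    have step : ∀ m : ℕ, n ≤ m →
        (s p (n + 1 : ℕ) m : ℚ) = PowerSeries.coeff (n + 1) (diagSum (patternKernel a b c d)
          (B + 1) (shefferWeight (patternKernel a b c d) * PowerSeries.mk 1 ^ (m + 2))) →
        (s p (n + 1 : ℕ) (m + 1 : ℕ) : ℚ) = PowerSeries.coeff (n + 1) (diagSum
          (patternKernel a b c d) (B + 1)
          (shefferWeight (patternKernel a b c d) * PowerSeries.mk 1 ^ (m + 1 + 2))) := by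
      intro m hm h
      have h1 := s_add_endsFirstCount p (n := (n + 1 : ℕ)) (m := (m + 1 : ℕ)) (by omega) (by omega)
      have h2 := hends (m + 1) (by omega)
      rw [coeff_succ_diagSum_mul_C_X_sub_X, ← h,
        ← (ih n (by omega) (by omega) (by omega : n ≤ m + 1)).1] at h2
      rw [show ((m + 1 : ℕ) : ℤ) - 1 = m by omega, show ((n + 1 : ℕ) : ℤ) - 1 = n by omega] at h1
      have h1' : (s p (n + 1 : ℕ) (m + 1 : ℕ) : ℚ) + (endsFirstCount p (n + 1 : ℕ) (m + 1 : ℕ) : ℚ)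
          = s p (n + 1 : ℕ) m + s p n (m + 1 : ℕ) := by exact_mod_cast h1
      linarith
    obtain ⟨m, rfl⟩ := Nat.exists_eq_add_of_le' (by omega : 1 ≤ m)
    have hm : n ≤ m := by omega
    refine step m hm ?_
    clear hnm
    induction m, hm using Nat.le_induction with
    | base =>
      rw [s_eq_zero_of_lt p (by omega), coeff_diagSum_shefferWeight hG _ (by omega) hn]
      push_cast
      ring
    | succ m hm ihm => exact step m hm ihm

/-- Explicit formula for ballot paths avoiding a depth-zero pattern `p` of dimensions
`a × c` with exactly one bifix `o`, where `p = p'' ++ o` and `p''` has dimensions `b × d`: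
for `m ≥ n ≥ 1`, with `N = n - (a-1)j - bk - (b-1)l`,
`s p n m = (m-n+1) ∑_{j,k,l ≥ 0, aj+(b+1)k+bl ≤ n} (-1)^{j+l} M(N;j,k,l) (1/N)
  C(m+n-(a+c-1)j-(b+d)(k+l), N-l-1)`,
where `C(x,y) = 0` for `y < 0` and `M` is the multinomial coefficient. -/
theorem ballot_avoiding_one_bifix_formula (p o p'' : Word) (a c b d : ℕ)
    (hdz : DepthZero p)
    (ho : IsBifix o p) (huniq : ∀ o' : Word, IsBifix o' p → o' = o)
    (hsplit : p = p'' ++ o)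
    (hdimR : countR p = a) (hdimU : countU p = c)
    (hdimR'' : countR p'' = b) (hdimU'' : countU p'' = d)
    (n m : ℕ) (hn : 1 ≤ n) (hnm : n ≤ m) :
    (s p n m : ℚ) = ((m : ℚ) - n + 1) *
      ∑ x ∈ Finset.filter
          (fun x : ℕ × ℕ × ℕ => a * x.1 + (b + 1) * x.2.1 + b * x.2.2 ≤ n)
          (Finset.range (n + 1) ×ˢ Finset.range (n + 1) ×ˢ Finset.range (n + 1)),
        (-1 : ℚ) ^ (x.1 + x.2.2) *
          ((Nat.factorial (n - (a - 1) * x.1 - b * x.2.1 - (b - 1) * x.2.2) /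
              (Nat.factorial x.1 * Nat.factorial x.2.1 * Nat.factorial x.2.2 *
                Nat.factorial ((n - (a - 1) * x.1 - b * x.2.1 - (b - 1) * x.2.2)
                  - x.1 - x.2.1 - x.2.2)) : ℕ) : ℚ) *
          (1 / ((n - (a - 1) * x.1 - b * x.2.1 - (b - 1) * x.2.2 : ℕ) : ℚ)) *
          (if x.2.2 < n - (a - 1) * x.1 - b * x.2.1 - (b - 1) * x.2.2 then
              ((Nat.choose (m + n - (a + c - 1) * x.1 - (b + d) * (x.2.1 + x.2.2))
                ((n - (a - 1) * x.1 - b * x.2.1 - (b - 1) * x.2.2) - x.2.2 - 1)) : ℚ)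
            else 0) := by

  have hp : p ≠ [] := by
    rintro rfl
    exact ho.1 (List.prefix_nil.1 ho.2.2.1)
  have ha : 1 ≤ a := hdimR ▸ hdz.countR_pos hp
  have hc : c ≤ a := hdimR ▸ hdimU ▸ hdz.countU_le
  have hd : d ≤ b := by
    obtain ⟨q, hq⟩ := ho.2.2.1
    have h1 := (hdz.suffix ⟨o, hq⟩).countU_le
    have h2 := congrArg countR (hq.trans hsplit)
    have h3 := congrArg countU (hq.trans hsplit)
    rw [countR_append, countR_append] at h2
    rw [countU_append, countU_append] at h3
    omega
  have hb : 1 ≤ b := by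
    by_contra hb0
    have hlen := countR_add_countU p''
    have : p'' = [] := List.eq_nil_of_length_eq_zero (by omega)
    exact ho.2.1 (by rw [hsplit, this, List.nil_append])
  rw [(s_eq_coeff_diagSum hdz ho huniq hsplit hdimR hdimU hdimR'' hdimU'' hb hd
    (Nat.lt_succ_self n) hnm).1]
  obtain ⟨a, rfl⟩ := Nat.exists_eq_add_of_le' ha
  obtain ⟨b, rfl⟩ := Nat.exists_eq_add_of_le' hb
  exact coeff_diagSum_patternKernel_eq_sum hc hd hn hnm
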